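/- Let K ≥ 2 and let Q be a real K×K matrix with trace equal to −γ. Let ω be an invertible complex K×K matrix and J a complex K×K matrix such that Q = ω⁻¹ J ω (viewing Q as a complex matrix). Suppose given an integer I ≥ 1, complex numbers θ_1, …, θ_{I−1}, positive integers m_1, …, m_{I−1} with m_1·θ_1 + ⋯ + m_{I−1}·θ_{I−1} = −γ, and indices k(1), …, k(I−1) ∈ {1, …, K} such that for every t ∈ ℝ and every i ∈ {1, …, I−1}, the k(i)-th row of exp(tJ) satisfies (exp(tJ))_{k(i), j} = 0 for all j ≠ k(i) and (exp(tJ))_{k(i), k(i)} = e^{t·θ_i}. Define F : ℝ^K → [0, ∞) by F(u) = Π_{i=1}^{I−1} |(ω u)_{k(i)}|^{m_i}. Then for every u ∈ ℝ^K and every t ∈ ℝ, F(exp(tQ)·u) = e^{−γ t}·F(u). -/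

import Mathlib

open Matrix Finset

/-- The entrywise embedding of real matrices into complex ones commutes with the exponential. -/
theorem Matrix.map_ofReal_exp {n : Type*} [Fintype n] [DecidableEq n] (A : Matrix n n ℝ) :
    (NormedSpace.exp A).map (fun a => (a : ℂ)) =
      NormedSpace.exp (A.map (fun a => (a : ℂ))) := by
  open scoped Matrix.Norms.Operator in
  exact NormedSpace.map_exp (Complex.ofRealHom.mapMatrix : Matrix n n ℝ →+* Matrix n n ℂ)
    (continuous_id.matrix_map Complex.continuous_ofReal) A

/-- If `Q = ω⁻¹ J ω` and the `k`-th row of `exp (t J)` is `c` times the `k`-th coordinate row,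
then the `k`-th coordinate of `ω u` is multiplied by `c` under `exp (t Q)`. -/
theorem Matrix.mulVec_exp_smul_of_conj {n : Type*} [Fintype n] [DecidableEq n]
    {Q : Matrix n n ℝ} {ω J : Matrix n n ℂ} (hω : IsUnit ω)
    (hQ : Q.map (fun a => (a : ℂ)) = ω⁻¹ * J * ω) {t : ℝ} {k : n} {c : ℂ}
    (hoff : ∀ j, j ≠ k → NormedSpace.exp ((t : ℂ) • J) k j = 0)
    (hdiag : NormedSpace.exp ((t : ℂ) • J) k k = c) (u : n → ℝ) :
    ω.mulVec (fun j => ((NormedSpace.exp (t • Q)).mulVec u j : ℂ)) k =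
      c * ω.mulVec (fun j => (u j : ℂ)) k := by
  have hscale : (t • Q).map (fun a => (a : ℂ)) = ω⁻¹ * ((t : ℂ) • J) * ω := by
    rw [Matrix.mul_smul, Matrix.smul_mul, ← hQ]
    ext i j
    simp
  have hvec : (fun j => ((NormedSpace.exp (t • Q)).mulVec u j : ℂ)) =
      (ω⁻¹ * NormedSpace.exp ((t : ℂ) • J) * ω).mulVec (fun j => (u j : ℂ)) := by
    rw [← Matrix.exp_conj' ω _ hω, ← hscale, ← Matrix.map_ofReal_exp]
    ext j
    simp [Matrix.mulVec, dotProduct]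
  rw [hvec, Matrix.mulVec_mulVec, ← Matrix.mul_assoc, ← Matrix.mul_assoc,
    Matrix.mul_nonsing_inv _ ((Matrix.isUnit_iff_isUnit_det _).mp hω), Matrix.one_mul,
    ← Matrix.mulVec_mulVec, Matrix.mulVec, dotProduct, Finset.sum_eq_single k, hdiag]
  · intro j _ hj
    rw [hoff j hj, zero_mul]
  · simp

/-- Key functional equation for the martingale construction: if `Q = ω⁻¹ J ω` with
`trace Q = -γ`, and the rows `k i` of `exp (t J)` are as in a Jordan normal form
(zero off the diagonal entry, `e^{t θ i}` on it), with `∑ i, m i • θ i = -γ`, then the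
function `F u = ∏ i, |(ω u)_{k i}|^{m i}` satisfies `F (exp (t Q) u) = e^{-γ t} F u`. -/
theorem jordan_F_functional_equation
    (K : ℕ) (hK : 2 ≤ K) (γ : ℝ)
    (Q : Matrix (Fin K) (Fin K) ℝ) (htrace : Matrix.trace Q = -γ)
    (ω J : Matrix (Fin K) (Fin K) ℂ) (hω : Invertible ω)
    (hQ : Q.map (fun a => (a : ℂ)) = ω⁻¹ * J * ω)
    (I : ℕ) (hI : 1 ≤ I)
    (θ : Fin (I - 1) → ℂ) (m : Fin (I - 1) → ℕ) (hm : ∀ i, 0 < m i)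
    (k : Fin (I - 1) → Fin K)
    (hsum : ∑ i, (m i : ℂ) * θ i = -(γ : ℂ))
    (hJ : ∀ (t : ℝ) (i : Fin (I - 1)),
      (∀ j, j ≠ k i → NormedSpace.exp ((t : ℂ) • J) (k i) j = 0) ∧
        NormedSpace.exp ((t : ℂ) • J) (k i) (k i) = Complex.exp ((t : ℂ) * θ i)) :
    ∀ (u : Fin K → ℝ) (t : ℝ),
      ∏ i, norm
          (ω.mulVec (fun j => ((NormedSpace.exp (t • Q)).mulVec u j : ℂ)) (k i)) ^ m i
        = Real.exp (-γ * t)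
            * ∏ i, norm (ω.mulVec (fun j => (u j : ℂ)) (k i)) ^ m i := by
  intro u t
  have hrow (i : Fin (I - 1)) :
      norm (ω.mulVec (fun j => ((NormedSpace.exp (t • Q)).mulVec u j : ℂ)) (k i)) ^ m i =
        Real.exp (t * (m i * (θ i).re)) *
          norm (ω.mulVec (fun j => (u j : ℂ)) (k i)) ^ m i := by
    rw [Matrix.mulVec_exp_smul_of_conj (isUnit_of_invertible ω) hQ (hJ t i).1 (hJ t i).2,
      norm_mul, mul_pow, Complex.norm_exp, Complex.re_ofReal_mul, ← Real.exp_nat_mul,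
      mul_left_comm]
  have hre : ∑ i, (m i : ℝ) * (θ i).re = -γ := by
    simpa using congrArg Complex.re hsum
  simp_rw [hrow]
  rw [Finset.prod_mul_distrib, ← Real.exp_sum, ← Finset.mul_sum, hre, mul_comm t]
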